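/- If X is a zero set for the ball algebra A(𝔹_d) and E ⊆ 𝕊_d is an A(𝔹_d)-totally null Borel set such that the closure of E is contained in X ∪ E, then X ∪ E is a zero set for A(𝔹_d). -/

import Mathlib

open MeasureTheory Metric Set Filter Topology

noncomputable section

abbrev CB (d : ℕ) : Set (EuclideanSpace ℂ (Fin d)) := Metric.closedBall 0 1

instance (d : ℕ) : CompactSpace (CB d) :=
  isCompact_iff_compactSpace.mp (isCompact_closedBall _ _)

instance (d : ℕ) : MeasurableSpace (EuclideanSpace ℂ (Fin d)) := borel _

instance (d : ℕ) : BorelSpace (EuclideanSpace ℂ (Fin d)) := ⟨rfl⟩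

def polyAlg (d : ℕ) : Subalgebra ℂ C(CB d, ℂ) :=
  Algebra.adjoin ℂ
    { f : C(CB d, ℂ) | ∃ i : Fin d,
        f = ⟨fun z => (z : EuclideanSpace ℂ (Fin d)) i,
             (EuclideanSpace.proj (𝕜 := ℂ) i).continuous.comp continuous_subtype_val⟩ }

def ballAlgSub (d : ℕ) : Subalgebra ℂ C(CB d, ℂ) := (polyAlg d).topologicalClosure

def ballAlg (d : ℕ) : Set C(CB d, ℂ) := ballAlgSub d

def sphereD (d : ℕ) : Set (CB d) := {z | ‖(z : EuclideanSpace ℂ (Fin d))‖ = 1}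

def openD (d : ℕ) : Set (CB d) := {z | ‖(z : EuclideanSpace ℂ (Fin d))‖ < 1}

def ZS (d : ℕ) (S : Set C(CB d, ℂ)) : Set (CB d) := {z | ∀ φ ∈ S, φ z = 0}

def IX (d : ℕ) (X : Set (CB d)) : Set C(CB d, ℂ) :=
  {φ | φ ∈ ballAlg d ∧ ∀ z ∈ X, φ z = 0}

def IsZeroSet (d : ℕ) (X : Set (CB d)) : Prop :=
  ∃ S ⊆ ballAlg d, X = ZS d S

/-- A representing measure for a point of the closed ball: a finite positive regular
Borel measure integrating every function of the ball algebra to its value at the point. -/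
def IsRepMeasure (d : ℕ) (lam : CB d) (μ : Measure (CB d)) : Prop :=
  IsFiniteMeasure μ ∧ μ.Regular ∧ ∀ φ ∈ ballAlg d, φ lam = ∫ z, φ z ∂μ

/-- `X̂₀` : `X₀` together with all points of the open ball having a representing measure
supported on `X₀`. -/
def hatSet (d : ℕ) (X0 : Set (CB d)) : Set (CB d) :=
  X0 ∪ {lam | lam ∈ openD d ∧
    ∃ μ : Measure (CB d), IsRepMeasure d lam μ ∧ μ X0ᶜ = 0}

/-- `z` is an isolated point of the set `A`. -/
def IsIsolatedIn (d : ℕ) (A : Set (CB d)) (z : CB d) : Prop :=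
  z ∈ A ∧ ∃ U : Set (CB d), IsOpen U ∧ U ∩ A = {z}

/-- A closed ideal of the ball algebra. -/
structure IsClosedIdeal (d : ℕ) (J : Set C(CB d, ℂ)) : Prop where
  subset : J ⊆ ballAlg d
  closed : IsClosed J
  zero_mem : (0 : C(CB d, ℂ)) ∈ J
  add_mem : ∀ f ∈ J, ∀ g ∈ J, f + g ∈ J
  smul_mem : ∀ (c : ℂ), ∀ f ∈ J, c • f ∈ J
  mul_mem : ∀ f ∈ ballAlg d, ∀ g ∈ J, f * g ∈ J

/-- An `A(𝔹_d)`-Henkin (finite positive regular Borel) measure on the sphere. -/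
def IsHenkin (d : ℕ) (μ : Measure (CB d)) : Prop :=
  IsFiniteMeasure μ ∧ μ.Regular ∧ μ (sphereD d)ᶜ = 0 ∧
    ∀ f : ℕ → C(CB d, ℂ), (∀ n, f n ∈ ballAlg d) → (∃ C : ℝ, ∀ n, ‖f n‖ ≤ C) →
      (∀ z ∈ openD d, Tendsto (fun n => f n z) atTop (𝓝 0)) →
      Tendsto (fun n => ∫ z, f n z ∂μ) atTop (𝓝 0)

/-- An `A(𝔹_d)`-totally null subset of the sphere. -/
def IsTotallyNull (d : ℕ) (K : Set (CB d)) : Prop :=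
  K ⊆ sphereD d ∧ ∀ μ : Measure (CB d), IsHenkin d μ → μ K = 0

/-- A complex regular Borel measure on the sphere, given by its polar decomposition:
total variation `var` (a finite positive regular Borel measure concentrated on the
sphere) and a unimodular density. -/
structure CMeasure (d : ℕ) where
  var : Measure (CB d)
  density : CB d → ℂ
  finite : IsFiniteMeasure var
  regular : var.Regular
  measurable_density : Measurable density
  norm_density : ∀ z, ‖density z‖ = 1
  onSphere : var (sphereD d)ᶜ = 0

/-- Integral of a continuous function against a complex measure. -/
def cInt (d : ℕ) (μ : CMeasure d) (φ : C(CB d, ℂ)) : ℂ :=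
  ∫ z, φ z * μ.density z ∂μ.var

/-- An `A(𝔹_d)`-Henkin complex measure on the sphere. -/
def IsHenkinC (d : ℕ) (μ : CMeasure d) : Prop :=
  ∀ f : ℕ → C(CB d, ℂ), (∀ n, f n ∈ ballAlg d) → (∃ C : ℝ, ∀ n, ‖f n‖ ≤ C) →
    (∀ z ∈ openD d, Tendsto (fun n => f n z) atTop (𝓝 0)) →
    Tendsto (fun n => cInt d μ (f n)) atTop (𝓝 0)

/-- An `A(𝔹_d)`-totally singular complex measure: its total variation is mutually
singular with that of every Henkin complex measure. -/
def IsTotallySingularC (d : ℕ) (μ : CMeasure d) : Prop :=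
  ∀ ν : CMeasure d, IsHenkinC d ν → μ.var ⟂ₘ ν.var

/-- An `A(𝔹_d)`-totally null Borel subset of the sphere (complex-measure version). -/
def IsTotallyNullC (d : ℕ) (K : Set (CB d)) : Prop :=
  K ⊆ sphereD d ∧ ∀ μ : CMeasure d, IsHenkinC d μ → μ.var K = 0

/-- The polynomial function on `ℂ^d` attached to a multivariate polynomial. -/
def polyFun {d : ℕ} (p : MvPolynomial (Fin d) ℂ) (z : EuclideanSpace ℂ (Fin d)) : ℂ :=
  MvPolynomial.eval (fun i => z i) p

section PolynomialEstimates

variable {d : ℕ}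

lemma polyFun_add (p q : MvPolynomial (Fin d) ℂ) (z : EuclideanSpace ℂ (Fin d)) :
    polyFun (p + q) z = polyFun p z + polyFun q z := by
  simp [polyFun]

lemma polyFun_mul (p q : MvPolynomial (Fin d) ℂ) (z : EuclideanSpace ℂ (Fin d)) :
    polyFun (p * q) z = polyFun p z * polyFun q z := by
  simp [polyFun]

lemma differentiable_polyFun (p : MvPolynomial (Fin d) ℂ) : Differentiable ℂ (polyFun p) := by
  have hc : ∀ i : Fin d, Differentiable ℂ (fun z : EuclideanSpace ℂ (Fin d) => z i) :=
    fun i => (EuclideanSpace.proj (𝕜 := ℂ) i).differentiable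
  induction p using MvPolynomial.induction_on with
  | C a =>
    have : polyFun (d := d) (MvPolynomial.C a) = fun _ => a := by ext; simp [polyFun]
    rw [this]; exact differentiable_const a
  | add p q hp hq =>
    have : polyFun (p + q) = fun z => polyFun p z + polyFun q z := funext (polyFun_add p q)
    rw [this]; exact hp.add hq
  | mul_X p i hp =>
    have : polyFun (p * MvPolynomial.X i) = fun z => polyFun p z * z i := by
      ext; simp [polyFun]
    rw [this]; exact hp.mul (hc i)

/-- Partial derivatives of polynomial functions are given by formal partial derivatives. -/
lemma fderiv_polyFun_single (p : MvPolynomial (Fin d) ℂ) (j : Fin d)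
    (z : EuclideanSpace ℂ (Fin d)) :
    fderiv ℂ (polyFun p) z (EuclideanSpace.single j 1) = polyFun (MvPolynomial.pderiv j p) z := by
  induction p using MvPolynomial.induction_on with
  | C a =>
    have : polyFun (d := d) (MvPolynomial.C a) = fun _ => a := by ext; simp [polyFun]
    rw [this]; simp [polyFun]
  | add p q hp hq =>
    have : polyFun (p + q) = fun z => polyFun p z + polyFun q z := funext (polyFun_add p q)
    rw [this, fderiv_fun_add (differentiable_polyFun p z) (differentiable_polyFun q z)]
    simp [hp, hq, polyFun_add]
  | mul_X p i hp =>
    have : polyFun (p * MvPolynomial.X i) =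
        fun z => polyFun p z * (EuclideanSpace.proj (𝕜 := ℂ) i) z := by
      ext; simp [polyFun]
    rw [this, fderiv_fun_mul (differentiable_polyFun p z)
      (EuclideanSpace.proj (𝕜 := ℂ) i).differentiableAt]
    simp only [ContinuousLinearMap.fderiv, add_apply,
      smul_apply, hp]
    rw [Derivation.leibniz, MvPolynomial.pderiv_X]
    by_cases h : i = j
    · subst h; simp [polyFun]
    · simp [polyFun, h]

lemma polyFun_monomial_smul (u : Fin d →₀ ℕ) (a t : ℂ) (z : EuclideanSpace ℂ (Fin d)) :
    polyFun (MvPolynomial.monomial u a) (t • z) =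
      t ^ (u.sum fun _ e => e) * polyFun (MvPolynomial.monomial u a) z := by
  simp only [polyFun, MvPolynomial.eval_monomial, Finsupp.prod, Finsupp.sum, PiLp.smul_apply,
    smul_eq_mul, mul_pow, Finset.prod_mul_distrib, Finset.prod_pow_eq_pow_sum]
  ring

/-- Radial averages of polynomials are polynomials: there is `Q` with
`t Q(tz) = ∫₀ᵗ q(sz) ds`, stated in differentiated form. -/
lemma exists_radial_primitive (q : MvPolynomial (Fin d) ℂ) :
    ∃ Q : MvPolynomial (Fin d) ℂ, ∀ (z : EuclideanSpace ℂ (Fin d)) (t : ℂ),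
      HasDerivAt (fun s : ℂ => s * polyFun Q (s • z)) (polyFun q (t • z)) t := by
  induction q using MvPolynomial.induction_on' with
  | monomial u a =>
    set n : ℕ := u.sum fun _ e => e with hn
    refine ⟨MvPolynomial.monomial u (a / (n + 1)), fun z t => ?_⟩
    have h : (fun s : ℂ => s * polyFun (MvPolynomial.monomial u (a / (n + 1))) (s • z)) =
        fun s : ℂ => s ^ (n + 1) * polyFun (MvPolynomial.monomial u (a / (n + 1))) z := by
      ext s; rw [polyFun_monomial_smul, ← hn]; ring
    rw [h, polyFun_monomial_smul, ← hn]
    have h2 := (hasDerivAt_pow (n + 1) t).mul_const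
      (polyFun (MvPolynomial.monomial u (a / (n + 1))) z)
    refine h2.congr_deriv ?_
    have : (n : ℂ) + 1 ≠ 0 := by exact_mod_cast Nat.succ_ne_zero n
    simp only [polyFun, MvPolynomial.eval_monomial]
    push_cast
    field_simp
  | add p q hp hq =>
    obtain ⟨P, hP⟩ := hp
    obtain ⟨Q, hQ⟩ := hq
    refine ⟨P + Q, fun z t => ?_⟩
    have h := (hP z t).add (hQ z t)
    rw [polyFun_add]
    refine h.congr_of_eventuallyEq (Filter.Eventually.of_forall fun s => ?_)
    simp only [polyFun_add, Pi.add_apply]; ring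

/-- Cauchy estimate for a directional derivative. -/
lemma norm_fderiv_le_of_circle {f : EuclideanSpace ℂ (Fin d) → ℂ} (hf : Differentiable ℂ f)
    (x v : EuclideanSpace ℂ (Fin d)) {s M : ℝ} (hs : 0 < s)
    (hM : ∀ lam : ℂ, ‖lam‖ = s → ‖f (x + lam • v)‖ ≤ M) : ‖fderiv ℂ f x v‖ ≤ M / s := by
  have hd : Differentiable ℂ (fun lam : ℂ => f (x + lam • v)) := by fun_prop
  have h := Complex.norm_deriv_le_of_forall_mem_sphere_norm_le (c := 0) hs hd.diffContOnCl
    (fun z hz => hM z (by simpa using hz))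
  have h2 : HasDerivAt (fun lam : ℂ => f (x + lam • v)) (fderiv ℂ f x v) 0 := by
    have h3 : HasDerivAt (fun lam : ℂ => x + lam • v) v 0 := by
      simpa using ((hasDerivAt_id (0 : ℂ)).smul_const v).const_add x
    have h4 : HasFDerivAt f (fderiv ℂ f x) (x + (0 : ℂ) • v) := by
      simpa using (hf x).hasFDerivAt
    exact h4.comp_hasDerivAt 0 h3
  rwa [h2.deriv] at h

/-- The tangential part of the `j`-th basis vector at a point of the sphere. -/
def tangentVec (j : Fin d) (z : EuclideanSpace ℂ (Fin d)) : EuclideanSpace ℂ (Fin d) :=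
  EuclideanSpace.single j 1 - (starRingEnd ℂ (z j)) • z

lemma inner_tangentVec (j : Fin d) {z : EuclideanSpace ℂ (Fin d)} (hz : ‖z‖ = 1) :
    inner ℂ z (tangentVec j z) = 0 := by
  simp [tangentVec, inner_self_eq_norm_sq_to_K, hz,
    EuclideanSpace.inner_single_right]

lemma norm_tangentVec_le (j : Fin d) {z : EuclideanSpace ℂ (Fin d)} (hz : ‖z‖ = 1) :
    ‖tangentVec j z‖ ≤ 1 := by
  have h : ‖(EuclideanSpace.single j 1 : EuclideanSpace ℂ (Fin d))‖ ^ 2 =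
      ‖(starRingEnd ℂ (z j)) • z‖ ^ 2 + ‖tangentVec j z‖ ^ 2 := by
    have h0 : (EuclideanSpace.single j 1 : EuclideanSpace ℂ (Fin d)) =
        (starRingEnd ℂ (z j)) • z + tangentVec j z := by simp [tangentVec]
    rw [h0, sq, sq, sq]
    apply norm_add_sq_eq_norm_sq_add_norm_sq_of_inner_eq_zero (𝕜 := ℂ)
    rw [inner_smul_left, inner_tangentVec j hz, mul_zero]
  simp only [PiLp.norm_single, norm_one] at h
  nlinarith [sq_nonneg ‖(starRingEnd ℂ (z j)) • z‖, norm_nonneg (tangentVec j z)]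

lemma norm_add_tangentVec_le (j : Fin d) {z : EuclideanSpace ℂ (Fin d)} (hz : ‖z‖ = 1)
    {t : ℝ} (ht0 : 0 ≤ t) (ht1 : t ≤ 1) {lam : ℂ} (hlam : ‖lam‖ = √(1 - t)) :
    ‖(t : ℂ) • z + lam • tangentVec j z‖ ≤ 1 := by
  have h : ‖(t : ℂ) • z + lam • tangentVec j z‖ ^ 2 =
      ‖(t : ℂ) • z‖ ^ 2 + ‖lam • tangentVec j z‖ ^ 2 := by
    rw [sq, sq, sq]
    apply norm_add_sq_eq_norm_sq_add_norm_sq_of_inner_eq_zero (𝕜 := ℂ)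
    rw [inner_smul_left, inner_smul_right, inner_tangentVec j hz, mul_zero, mul_zero]
  have h1 : ‖(t : ℂ) • z‖ = t := by
    rw [norm_smul, hz, mul_one, Complex.norm_real, Real.norm_of_nonneg ht0]
  have h2 : ‖lam • tangentVec j z‖ ^ 2 ≤ 1 - t := by
    rw [norm_smul, mul_pow, hlam, Real.sq_sqrt (by linarith)]
    have := norm_tangentVec_le j hz
    have h3 : ‖tangentVec j z‖ ^ 2 ≤ 1 := by
      nlinarith [norm_nonneg (tangentVec j z)]
    nlinarith
  rw [h1] at h
  nlinarith [norm_nonneg ((t : ℂ) • z + lam • tangentVec j z)]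

/-- Multiplication by `conj z_j`, up to an error controlled by interior values, is
given by a polynomial. -/
lemma norm_conj_mul_sub_le (p Q : MvPolynomial (Fin d) ℂ) (j : Fin d)
    (hQ : ∀ (z : EuclideanSpace ℂ (Fin d)) (t : ℂ),
      HasDerivAt (fun s : ℂ => s * polyFun Q (s • z))
        (polyFun (MvPolynomial.pderiv j p) (t • z)) t)
    {C η t₀ : ℝ} (ht0 : 0 ≤ t₀) (ht1 : t₀ < 1)
    (hC : ∀ z : EuclideanSpace ℂ (Fin d), ‖z‖ ≤ 1 → ‖polyFun p z‖ ≤ C)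
    (hη : ∀ z : EuclideanSpace ℂ (Fin d), ‖z‖ ≤ (1 + t₀) / 2 → ‖polyFun p z‖ ≤ η)
    {z : EuclideanSpace ℂ (Fin d)} (hz : ‖z‖ = 1) :
    ‖starRingEnd ℂ (z j) * polyFun p z - polyFun Q z‖ ≤
      η + 2 * η / (1 - t₀) + 2 * C * √(1 - t₀) := by
  set v := tangentVec j z with hv
  set u : ℝ → ℂ := fun t =>
    starRingEnd ℂ (z j) * polyFun p ((t : ℂ) • z) - t * polyFun Q ((t : ℂ) • z) with hu
  have hη0 : 0 ≤ η := (norm_nonneg _).trans (hη 0 (by simp; linarith))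
  have hC0 : 0 ≤ C := (norm_nonneg _).trans (hC 0 (by simp))
  have hzj : ‖z j‖ ≤ 1 := hz ▸ PiLp.norm_apply_le z j
  have hder : ∀ t : ℝ, HasDerivAt u (-(fderiv ℂ (polyFun p) ((t : ℂ) • z) v)) t := by
    intro t
    have h1 : HasDerivAt (fun s : ℂ => s • z) z (t : ℂ) := by
      simpa using (hasDerivAt_id (t : ℂ)).smul_const z
    have h2 : HasDerivAt (fun s : ℂ => polyFun p (s • z))
        (fderiv ℂ (polyFun p) ((t : ℂ) • z) z) (t : ℂ) :=
      (differentiable_polyFun p _).hasFDerivAt.comp_hasDerivAt (t : ℂ) h1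
    have h3 := ((h2.const_mul (starRingEnd ℂ (z j))).sub (hQ z t)).comp_ofReal
    refine h3.congr_deriv ?_
    rw [hv, tangentVec, map_sub, map_smul, fderiv_polyFun_single]
    simp
  have hcont : Continuous u := continuous_iff_continuousAt.2 fun t => (hder t).continuousAt
  have hin : ‖u t₀ - u 0‖ ≤ 2 * η / (1 - t₀) := by
    have h := norm_image_sub_le_of_norm_deriv_le_segment' (f := u) (a := 0) (b := t₀)
      (C := η / ((1 - t₀) / 2)) (fun t _ => (hder t).hasDerivWithinAt) ?_ t₀
      (right_mem_Icc.2 ht0)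
    · refine h.trans ?_
      have h5 : 0 ≤ η / ((1 - t₀) / 2) := div_nonneg hη0 (by linarith)
      calc η / ((1 - t₀) / 2) * (t₀ - 0) ≤ η / ((1 - t₀) / 2) * 1 := by gcongr; linarith
        _ = 2 * η / (1 - t₀) := by
          have : 1 - t₀ ≠ 0 := by linarith
          field_simp
    · intro t ht
      rw [norm_neg]
      refine norm_fderiv_le_of_circle (differentiable_polyFun p) _ _ (by linarith) ?_
      intro lam hlam
      apply hη
      refine (norm_add_le _ _).trans ?_
      rw [norm_smul, norm_smul, hz, hlam, Complex.norm_real, Real.norm_of_nonneg ht.1]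
      have := norm_tangentVec_le j hz
      nlinarith [ht.2]
  have hout : ‖u 1 - u t₀‖ ≤ 2 * C * √(1 - t₀) := by
    have h := image_norm_le_of_norm_deriv_right_le_deriv_boundary'
      (f := fun t => u t - u t₀) (a := t₀) (b := 1)
      (f' := fun t => -(fderiv ℂ (polyFun p) ((t : ℂ) • z) v))
      (B := fun t => 2 * C * √(1 - t₀) - 2 * C * √(1 - t)) (B' := fun t => C / √(1 - t))
      (by fun_prop) (fun t _ => ((hder t).sub_const _).hasDerivWithinAt) (by simp)
      (by fun_prop) ?_ ?_ (right_mem_Icc.2 ht1.le)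
    · simpa using h
    · intro t ht
      have h6 : (1 : ℝ) - t ≠ 0 := by linarith [ht.2]
      have h5 : HasDerivAt (fun t : ℝ => √(1 - t)) (-1 / (2 * √(1 - t))) t :=
        ((hasDerivAt_id t).const_sub 1).sqrt h6
      have h7 := (h5.const_mul (2 * C)).const_sub (2 * C * √(1 - t₀))
      refine HasDerivAt.hasDerivWithinAt ?_
      convert h7 using 1
      have : √(1 - t) ≠ 0 := (Real.sqrt_pos.2 (by linarith [ht.2])).ne'
      field_simp
    · intro t ht
      rw [norm_neg]
      refine norm_fderiv_le_of_circle (differentiable_polyFun p) _ _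
        (Real.sqrt_pos.2 (by linarith [ht.2])) ?_
      intro lam hlam
      exact hC _ (norm_add_tangentVec_le j hz (ht0.trans ht.1) ht.2.le hlam)
  have h0 : ‖u 0‖ ≤ η := by
    simp only [hu, Complex.ofReal_zero, zero_smul, zero_mul, sub_zero, norm_mul,
      RCLike.norm_conj]
    have := hη 0 (by simp; linarith)
    nlinarith [norm_nonneg (polyFun p 0), norm_nonneg (z j)]
  have h1 : u 1 = starRingEnd ℂ (z j) * polyFun p z - polyFun Q z := by simp [hu]
  rw [← h1]
  calc ‖u 1‖ = ‖u 0 + (u t₀ - u 0) + (u 1 - u t₀)‖ := by congr 1; ring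
    _ ≤ ‖u 0‖ + ‖u t₀ - u 0‖ + ‖u 1 - u t₀‖ := norm_add₃_le
    _ ≤ _ := by gcongr

/-- Interior bound for a radial average of a partial derivative. -/
lemma norm_radial_primitive_le (p Q : MvPolynomial (Fin d) ℂ) (j : Fin d)
    (hQ : ∀ (z : EuclideanSpace ℂ (Fin d)) (t : ℂ),
      HasDerivAt (fun s : ℂ => s * polyFun Q (s • z))
        (polyFun (MvPolynomial.pderiv j p) (t • z)) t)
    {η : ℝ} {z : EuclideanSpace ℂ (Fin d)} (hz : ‖z‖ < 1)
    (hη : ∀ w : EuclideanSpace ℂ (Fin d), ‖w‖ ≤ (1 + ‖z‖) / 2 → ‖polyFun p w‖ ≤ η) :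
    ‖polyFun Q z‖ ≤ η / ((1 - ‖z‖) / 2) := by
  have h := norm_image_sub_le_of_norm_deriv_le_segment'
    (f := fun t : ℝ => (t : ℂ) * polyFun Q ((t : ℂ) • z)) (a := 0) (b := 1)
    (f' := fun t => polyFun (MvPolynomial.pderiv j p) ((t : ℂ) • z))
    (C := η / ((1 - ‖z‖) / 2)) (fun t _ => (hQ z t).comp_ofReal.hasDerivWithinAt) ?_ 1
    (right_mem_Icc.2 zero_le_one)
  · simpa using h
  · intro t ht
    rw [← fderiv_polyFun_single]
    refine norm_fderiv_le_of_circle (differentiable_polyFun p) _ _ (by linarith) ?_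
    intro lam hlam
    apply hη
    refine (norm_add_le _ _).trans ?_
    rw [norm_smul, norm_smul, hlam, Complex.norm_real, Real.norm_of_nonneg ht.1]
    simp only [PiLp.norm_single, norm_one]
    nlinarith [ht.2, norm_nonneg z]

/-- A bounded sequence of polynomials converging pointwise to `0` on the open ball converges
uniformly on smaller balls. -/
lemma eventually_uniform_small (p : ℕ → MvPolynomial (Fin d) ℂ) {C : ℝ}
    (hC : ∀ n, ∀ z : EuclideanSpace ℂ (Fin d), ‖z‖ ≤ 1 → ‖polyFun (p n) z‖ ≤ C)
    (hp : ∀ z : EuclideanSpace ℂ (Fin d), ‖z‖ < 1 →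
      Tendsto (fun n => polyFun (p n) z) atTop (𝓝 0))
    {ρ η : ℝ} (hρ : ρ < 1) (hη : 0 < η) :
    ∀ᶠ n in atTop, ∀ z : EuclideanSpace ℂ (Fin d), ‖z‖ ≤ ρ → ‖polyFun (p n) z‖ ≤ η := by
  have hC0 : 0 ≤ C := (norm_nonneg _).trans (hC 0 0 (by simp))
  set R : ℝ := 1 - ρ with hR
  have hR0 : 0 < R := by linarith
  set e : ℝ := min R (η / 2 / (2 * C / R + 1)) with he
  have he0 : 0 < e := lt_min hR0 (by positivity)
  obtain ⟨t, hts, htf, htc⟩ :=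
    (isCompact_closedBall (0 : EuclideanSpace ℂ (Fin d)) ρ).finite_cover_balls he0
  have hev : ∀ᶠ n in atTop, ∀ x ∈ t, ‖polyFun (p n) x‖ ≤ η / 2 := by
    rw [htf.eventually_all]
    intro x hx
    have hx1 : ‖x‖ < 1 := lt_of_le_of_lt (by simpa using hts hx) hρ
    have := (hp x hx1).norm
    rw [norm_zero] at this
    exact this.eventually_le_const (by positivity)
  filter_upwards [hev] with n hn z hz
  obtain ⟨x, hx, hzx⟩ := mem_iUnion₂.1 (htc (by simpa using hz : z ∈ closedBall 0 ρ))
  have hxρ : ‖x‖ ≤ ρ := by simpa using hts hx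
  have hball : ∀ w ∈ ball x R, ‖w‖ ≤ 1 := by
    intro w hw
    have : ‖w‖ ≤ ‖w - x‖ + ‖x‖ := by simpa using norm_add_le (w - x) x
    rw [mem_ball, dist_eq_norm] at hw
    linarith
  have h := Complex.dist_le_div_mul_dist_of_mapsTo_ball (f := polyFun (p n)) (c := x)
    (R₁ := R) (R₂ := 2 * C) (z := z) (differentiable_polyFun _).differentiableOn ?_
    (ball_subset_ball (min_le_left _ _) hzx)
  · rw [dist_eq_norm] at h
    have hd : dist z x ≤ η / 2 / (2 * C / R + 1) := (mem_ball.1 hzx).le.trans (min_le_right _ _)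
    have h2 : 2 * C / R * dist z x ≤ η / 2 := by
      have hpos : 0 < 2 * C / R + 1 := by positivity
      rw [le_div_iff₀ hpos] at hd
      nlinarith [dist_nonneg (x := z) (y := x)]
    have h3 := hn x hx
    calc ‖polyFun (p n) z‖ = ‖(polyFun (p n) z - polyFun (p n) x) + polyFun (p n) x‖ := by
          congr 1; ring
      _ ≤ _ := norm_add_le _ _
      _ ≤ η := by linarith
  · intro w hw
    rw [mem_closedBall, dist_eq_norm]
    refine (norm_sub_le _ _).trans ?_
    linarith [hC n w (hball w hw), hC n x (by linarith)]

/-- Maximum principle on the unit ball. -/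
lemma norm_polyFun_le_of_sphere (hd : 1 ≤ d) (p : MvPolynomial (Fin d) ℂ) {C : ℝ}
    (hC : ∀ z : EuclideanSpace ℂ (Fin d), ‖z‖ = 1 → ‖polyFun p z‖ ≤ C)
    {z : EuclideanSpace ℂ (Fin d)} (hz : ‖z‖ ≤ 1) : ‖polyFun p z‖ ≤ C := by
  have : Nonempty (Fin d) := ⟨⟨0, hd⟩⟩
  have : Nontrivial (EuclideanSpace ℂ (Fin d)) :=
    ⟨⟨EuclideanSpace.single ⟨0, hd⟩ 1, 0, by
      intro h
      have := congrArg norm h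
      simp at this⟩⟩
  refine Complex.norm_le_of_forall_mem_frontier_norm_le (U := ball 0 1) isBounded_ball
    (differentiable_polyFun p).diffContOnCl ?_ ?_
  · intro w hw
    let : NormedSpace ℝ (EuclideanSpace ℂ (Fin d)) := NormedSpace.restrictScalars ℝ ℂ _
    rw [frontier_ball _ one_ne_zero] at hw
    exact hC w (by simpa using hw)
  · rw [closure_ball _ one_ne_zero]; simpa using hz

end PolynomialEstimates

section BallAlgebra

variable {d : ℕ}

/-- A multivariate polynomial as a continuous function on the closed ball. -/
def polyCM (p : MvPolynomial (Fin d) ℂ) : C(CB d, ℂ) :=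
  ⟨fun z => polyFun p z, (differentiable_polyFun p).continuous.comp continuous_subtype_val⟩

@[simp] lemma polyCM_apply (p : MvPolynomial (Fin d) ℂ) (z : CB d) :
    polyCM p z = polyFun p (z : EuclideanSpace ℂ (Fin d)) := rfl

/-- The `i`-th coordinate function on the closed ball. -/
def coordCM (i : Fin d) : C(CB d, ℂ) :=
  ⟨fun z => (z : EuclideanSpace ℂ (Fin d)) i,
    (EuclideanSpace.proj (𝕜 := ℂ) i).continuous.comp continuous_subtype_val⟩

@[simp] lemma coordCM_apply (i : Fin d) (z : CB d) :
    coordCM i z = (z : EuclideanSpace ℂ (Fin d)) i := rfl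

lemma norm_coe_le_one (z : CB d) : ‖(z : EuclideanSpace ℂ (Fin d))‖ ≤ 1 :=
  mem_closedBall_zero_iff.1 z.2

lemma mem_polyAlg_iff {f : C(CB d, ℂ)} : f ∈ polyAlg d ↔ ∃ p, polyCM p = f := by
  have hset : { f : C(CB d, ℂ) | ∃ i : Fin d,
        f = ⟨fun z => (z : EuclideanSpace ℂ (Fin d)) i,
             (EuclideanSpace.proj (𝕜 := ℂ) i).continuous.comp continuous_subtype_val⟩ } =
      range (coordCM (d := d)) := by
    ext f; simp only [mem_ofPred_eq, mem_range, coordCM, eq_comm]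
  have haeval : ∀ p : MvPolynomial (Fin d) ℂ, MvPolynomial.aeval (coordCM (d := d)) p = polyCM p := by
    intro p
    induction p using MvPolynomial.induction_on with
    | C a => ext z; simp [polyFun]
    | add p q hp hq => rw [map_add, hp, hq]; ext z; simp [polyFun_add]
    | mul_X p i hp =>
      rw [map_mul, hp, MvPolynomial.aeval_X]; ext z; simp [polyFun]
  rw [polyAlg, hset, Algebra.adjoin_range_eq_range_aeval]
  simp [AlgHom.mem_range, haeval]

lemma polyCM_mem_ballAlg (p : MvPolynomial (Fin d) ℂ) : polyCM p ∈ ballAlg d :=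
  (polyAlg d).le_topologicalClosure (mem_polyAlg_iff.2 ⟨p, rfl⟩)

lemma isClosed_ballAlg : IsClosed (ballAlg d) := (polyAlg d).isClosed_topologicalClosure

lemma exists_polyCM_near {f : C(CB d, ℂ)} (hf : f ∈ ballAlg d) {ε : ℝ} (hε : 0 < ε) :
    ∃ p, ‖polyCM p - f‖ < ε := by
  have hf' : f ∈ closure (polyAlg d : Set C(CB d, ℂ)) := hf
  obtain ⟨g, hg, hfg⟩ := Metric.mem_closure_iff.1 hf' ε hε
  obtain ⟨p, rfl⟩ := mem_polyAlg_iff.1 hg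
  exact ⟨p, by rwa [← dist_eq_norm, dist_comm]⟩

/-- Maximum principle for the ball algebra. -/
lemma norm_le_of_sphereD (hd : 1 ≤ d) {f : C(CB d, ℂ)} (hf : f ∈ ballAlg d) {C : ℝ} (hC0 : 0 ≤ C)
    (hC : ∀ z ∈ sphereD d, ‖f z‖ ≤ C) : ‖f‖ ≤ C := by
  refine (ContinuousMap.norm_le _ hC0).2 fun z => le_of_forall_pos_le_add fun ε hε => ?_
  obtain ⟨p, hp⟩ := exists_polyCM_near hf (half_pos hε)
  have hpt : ∀ x, ‖polyCM p x - f x‖ ≤ ε / 2 := fun x =>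
    ((polyCM p - f).norm_coe_le_norm x).trans hp.le
  have h1 : ‖polyFun p (z : EuclideanSpace ℂ (Fin d))‖ ≤ C + ε / 2 := by
    refine norm_polyFun_le_of_sphere hd p (fun w hw => ?_) (norm_coe_le_one z)
    have h := hpt ⟨w, by simp [hw]⟩
    have h2 := hC ⟨w, by simp [hw]⟩ hw
    rw [polyCM_apply] at h
    have h3 := norm_le_insert' (polyFun p w) (f ⟨w, by simp [hw]⟩)
    linarith
  have h4 := norm_le_insert' (f z) (polyCM p z)
  rw [norm_sub_rev, polyCM_apply] at h4
  have h5 := hpt z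
  rw [polyCM_apply] at h5
  linarith

/-- A sup-norm bounded sequence of polynomials converging pointwise to `0` on the open ball. -/
def IsNullSeq (p : ℕ → MvPolynomial (Fin d) ℂ) : Prop :=
  (∃ C : ℝ, ∀ n, ∀ z : EuclideanSpace ℂ (Fin d), ‖z‖ ≤ 1 → ‖polyFun (p n) z‖ ≤ C) ∧
    ∀ z : EuclideanSpace ℂ (Fin d), ‖z‖ < 1 → Tendsto (fun n => polyFun (p n) z) atTop (𝓝 0)

/-- Multiplication by `conj z_j` sends a null sequence to a null sequence, up to an error that
tends to `0` uniformly on the sphere. -/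
lemma IsNullSeq.exists_conj (hd : 1 ≤ d) {p : ℕ → MvPolynomial (Fin d) ℂ} (hp : IsNullSeq p)
    (j : Fin d) :
    ∃ q : ℕ → MvPolynomial (Fin d) ℂ, IsNullSeq q ∧ ∀ ε : ℝ, 0 < ε → ∀ᶠ n in atTop,
      ∀ z : EuclideanSpace ℂ (Fin d), ‖z‖ = 1 →
        ‖starRingEnd ℂ (z j) * polyFun (p n) z - polyFun (q n) z‖ ≤ ε := by
  obtain ⟨⟨C, hC⟩, hp0⟩ := hp
  have hC0 : 0 ≤ C := (norm_nonneg _).trans (hC 0 0 (by simp))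
  choose q hq using fun n => exists_radial_primitive (MvPolynomial.pderiv j (p n))
  refine ⟨q, ⟨⟨6 * C, fun n z hz => ?_⟩, fun z hz => ?_⟩, fun ε hε => ?_⟩
  · refine norm_polyFun_le_of_sphere hd _ (fun w hw => ?_) hz
    have h := norm_conj_mul_sub_le (p n) (q n) j (hq n) (C := C) (η := C) le_rfl zero_lt_one
      (hC n) (fun z hz => hC n z (by linarith)) hw
    have hwj : ‖w j‖ ≤ 1 := hw ▸ PiLp.norm_apply_le w j
    have h2 : ‖starRingEnd ℂ (w j) * polyFun (p n) w‖ ≤ C := by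
      rw [norm_mul, RCLike.norm_conj]
      nlinarith [hC n w hw.le, norm_nonneg (w j), norm_nonneg (polyFun (p n) w)]
    have h3 := norm_le_insert' (polyFun (q n) w) (starRingEnd ℂ (w j) * polyFun (p n) w)
    rw [norm_sub_rev] at h3
    simp only [sub_zero, div_one, Real.sqrt_one, mul_one] at h
    linarith
  · rw [Metric.tendsto_atTop']
    intro ε hε
    have hpos : 0 < (1 - ‖z‖) / 2 := by linarith
    have h := eventually_uniform_small p hC hp0 (ρ := (1 + ‖z‖) / 2)
      (η := ε / 2 * ((1 - ‖z‖) / 2)) (by linarith) (by positivity)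
    obtain ⟨N, hN⟩ := eventually_atTop.1 h
    refine ⟨N, fun n hn => ?_⟩
    rw [dist_zero_right]
    have h2 := norm_radial_primitive_le (p n) (q n) j (hq n) hz (hN n hn.le)
    rw [mul_div_assoc, div_self hpos.ne', mul_one] at h2
    linarith
  · set r : ℝ := min 1 (ε / (4 * (C + 1))) with hr
    have hr0 : 0 < r := lt_min one_pos (by positivity)
    have hr1 : r ≤ 1 := min_le_left _ _
    have hrC : 2 * C * r ≤ ε / 2 := by
      have : r ≤ ε / (4 * (C + 1)) := min_le_right _ _
      rw [le_div_iff₀ (by positivity)] at this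
      nlinarith
    set t₀ : ℝ := 1 - r ^ 2 with ht
    have ht0 : 0 ≤ t₀ := by nlinarith
    have ht1 : t₀ < 1 := by nlinarith
    have hsub : 1 - t₀ = r ^ 2 := by ring
    have h := eventually_uniform_small p hC hp0 (ρ := (1 + t₀) / 2)
      (η := ε / 6 * r ^ 2) (by linarith) (by positivity)
    filter_upwards [h] with n hn z hz
    refine (norm_conj_mul_sub_le (p n) (q n) j (hq n) ht0 ht1 (hC n) hn hz).trans ?_
    rw [hsub, Real.sqrt_sq hr0.le]
    have h1 : 2 * (ε / 6 * r ^ 2) / r ^ 2 = ε / 3 := by field_simp; norm_num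
    have h2 : ε / 6 * r ^ 2 ≤ ε / 6 := by
      have : r ^ 2 ≤ 1 := by nlinarith
      nlinarith
    linarith

/-- Henkin's theorem for functionals: a functional annihilating the ball algebra and continuous
for the sup norm over the sphere and one extra point stays Henkin after multiplication by any
continuous function. -/
lemma tendsto_mul_of_annihilates (hd : 1 ≤ d) (L : C(CB d, ℂ) →L[ℂ] ℂ)
    (hL : ∀ f ∈ ballAlg d, L f = 0) (z₀ : CB d) (c : ℝ)
    (hLb : ∀ (f : C(CB d, ℂ)) (s : ℝ), (∀ x ∈ insert z₀ (sphereD d), ‖f x‖ ≤ s) → ‖L f‖ ≤ c * s)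
    (g : C(CB d, ℂ)) (f : ℕ → C(CB d, ℂ)) (hf : ∀ n, f n ∈ ballAlg d)
    (hfb : ∃ C : ℝ, ∀ n, ‖f n‖ ≤ C)
    (hf0 : ∀ z ∈ openD d, Tendsto (fun n => f n z) atTop (𝓝 0)) :
    Tendsto (fun n => L (g * f n)) atTop (𝓝 0) := by
  let P : C(CB d, ℂ) → Prop := fun g => ∀ p : ℕ → MvPolynomial (Fin d) ℂ, IsNullSeq p →
    Tendsto (fun n => L (g * polyCM (p n))) atTop (𝓝 0)
  have hPadd : ∀ g h, P g → P h → P (g + h) := by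
    intro g h hg hh p hp
    simpa [add_mul] using (hg p hp).add (hh p hp)
  have hPsmul : ∀ (a : ℂ) g, P g → P (a • g) := by
    intro a g hg p hp
    simpa using (hg p hp).const_mul a
  have hP1 : P 1 := by
    intro p hp
    simp [hL _ (polyCM_mem_ballAlg _)]
  have hPlim : ∀ g, (∀ ε > 0, ∃ h, P h ∧ ‖g - h‖ < ε) → P g := by
    intro g hg p hp
    obtain ⟨C, hC⟩ := hp.1
    have hC0 : 0 ≤ C := (norm_nonneg _).trans (hC 0 0 (by simp))
    have hpC : ∀ n, ‖polyCM (p n)‖ ≤ C := fun n =>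
      (ContinuousMap.norm_le _ hC0).2 fun z => hC n z (norm_coe_le_one z)
    rw [Metric.tendsto_atTop']
    intro ε hε
    obtain ⟨h, hPh, hgh⟩ := hg (ε / 2 / ((‖L‖ + 1) * (C + 1))) (by positivity)
    obtain ⟨N, hN⟩ := Metric.tendsto_atTop'.1 (hPh p hp) (ε / 2) (half_pos hε)
    refine ⟨N, fun n hn => ?_⟩
    have h1 := hN n hn
    rw [dist_zero_right] at h1 ⊢
    have h2 : L (g * polyCM (p n)) = L ((g - h) * polyCM (p n)) + L (h * polyCM (p n)) := by
      rw [← map_add, sub_mul, sub_add_cancel]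
    have h3 : ‖L ((g - h) * polyCM (p n))‖ ≤ ε / 2 := by
      calc ‖L ((g - h) * polyCM (p n))‖ ≤ ‖L‖ * (‖g - h‖ * ‖polyCM (p n)‖) :=
            (L.le_opNorm _).trans (by gcongr; exact norm_mul_le _ _)
        _ ≤ (‖L‖ + 1) * (ε / 2 / ((‖L‖ + 1) * (C + 1)) * (C + 1)) := by
            gcongr
            · linarith
            · linarith [hpC n]
        _ = ε / 2 := by field_simp
    rw [h2]
    linarith [norm_add_le (L ((g - h) * polyCM (p n))) (L (h * polyCM (p n)))]
  have hPcoord : ∀ j g, P g → P (coordCM j * g) := by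
    intro j g hg p hp
    have hq : IsNullSeq (fun n => MvPolynomial.X j * p n) := by
      obtain ⟨⟨C, hC⟩, hp0⟩ := hp
      refine ⟨⟨C, fun n z hz => ?_⟩, fun z hz => ?_⟩
      · rw [polyFun_mul, norm_mul]
        have h1 : ‖polyFun (MvPolynomial.X j) z‖ ≤ 1 := by
          simpa [polyFun] using (PiLp.norm_apply_le z j).trans hz
        nlinarith [hC n z hz, norm_nonneg (polyFun (p n) z)]
      · simpa [polyFun_mul] using (hp0 z hz).const_mul (polyFun (MvPolynomial.X j) z)
    refine (hg _ hq).congr fun n => ?_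
    congr 1
    ext z
    simp [polyFun]; ring
  have hPconj : ∀ j g, P g → P (star (coordCM j) * g) := by
    intro j g hg p hp
    obtain ⟨q, hq, hqe⟩ := hp.exists_conj hd j
    have hunif : ∀ ε : ℝ, 0 < ε → ∀ᶠ n in atTop, ∀ x ∈ insert z₀ (sphereD d),
        ‖(star (coordCM j) * polyCM (p n) - polyCM (q n)) x‖ ≤ ε := by
      intro ε hε
      have hz : ∀ᶠ n in atTop, ‖(star (coordCM j) * polyCM (p n) - polyCM (q n)) z₀‖ ≤ ε := by
        rcases (norm_coe_le_one z₀).lt_or_eq with h | h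
        · have h1 := (((hp.2 _ h).const_mul (star (coordCM j z₀))).sub (hq.2 _ h)).norm
          rw [mul_zero, sub_zero, norm_zero] at h1
          exact h1.eventually_le_const hε
        · exact (hqe ε hε).mono fun n hn => hn _ h
      filter_upwards [hz, hqe ε hε] with n h1 h2 x hx
      rcases hx with rfl | hx
      · exact h1
      · exact h2 _ hx
    have herr : Tendsto (fun n => L (g * (star (coordCM j) * polyCM (p n) - polyCM (q n))))
        atTop (𝓝 0) := by
      rw [Metric.tendsto_atTop']
      intro ε hε
      obtain ⟨N, hN⟩ := eventually_atTop.1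
        (hunif (ε / 2 / ((|c| + 1) * (‖g‖ + 1))) (by positivity))
      refine ⟨N, fun n hn => ?_⟩
      rw [dist_zero_right]
      have h1 := hLb (g * (star (coordCM j) * polyCM (p n) - polyCM (q n)))
        ((‖g‖ + 1) * (ε / 2 / ((|c| + 1) * (‖g‖ + 1)))) (fun x hx => by
          rw [ContinuousMap.mul_apply, norm_mul]
          gcongr
          · linarith [g.norm_coe_le_norm x]
          · exact hN n hn.le x hx)
      have h2 : (|c| + 1) * ((‖g‖ + 1) * (ε / 2 / ((|c| + 1) * (‖g‖ + 1)))) = ε / 2 := by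
        field_simp
      have h3 : c * ((‖g‖ + 1) * (ε / 2 / ((|c| + 1) * (‖g‖ + 1)))) ≤
          (|c| + 1) * ((‖g‖ + 1) * (ε / 2 / ((|c| + 1) * (‖g‖ + 1)))) := by
        gcongr
        linarith [le_abs_self c]
      linarith
    have hsum := (hg q hq).add herr
    rw [add_zero] at hsum
    refine hsum.congr fun n => ?_
    rw [← map_add]
    congr 1
    ring
  let S : StarSubalgebra ℂ C(CB d, ℂ) := StarAlgebra.adjoin ℂ (range (coordCM (d := d)))
  have hS : ∀ m ∈ S, ∀ g, P g → P (m * g) := by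
    intro m hm
    suffices h : (∀ g, P g → P (m * g)) ∧ (∀ g, P g → P (star m * g)) from h.1
    induction hm using StarAlgebra.adjoin_induction with
    | mem x hx =>
      obtain ⟨j, rfl⟩ := hx
      exact ⟨hPcoord j, hPconj j⟩
    | algebraMap r =>
      refine ⟨fun g hg => ?_, fun g hg => ?_⟩
      · rw [← Algebra.smul_def]; exact hPsmul r g hg
      · rw [← algebraMap_star_comm, ← Algebra.smul_def]; exact hPsmul _ g hg
    | add x y _ _ hx hy =>
      refine ⟨fun g hg => ?_, fun g hg => ?_⟩
      · rw [add_mul]; exact hPadd _ _ (hx.1 g hg) (hy.1 g hg)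
      · rw [star_add, add_mul]; exact hPadd _ _ (hx.2 g hg) (hy.2 g hg)
    | mul x y _ _ hx hy =>
      refine ⟨fun g hg => ?_, fun g hg => ?_⟩
      · rw [mul_assoc]; exact hx.1 _ (hy.1 g hg)
      · rw [star_mul, mul_assoc]; exact hy.2 _ (hx.2 g hg)
    | star x _ hx => exact ⟨hx.2, by simpa using hx.1⟩
  have hSdense : S.topologicalClosure = ⊤ := by
    refine ContinuousMap.starSubalgebra_topologicalClosure_eq_top_of_separatesPoints S ?_
    intro x y hxy
    have : ∃ i, (x : EuclideanSpace ℂ (Fin d)) i ≠ (y : EuclideanSpace ℂ (Fin d)) i := by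
      by_contra! h
      exact hxy (Subtype.ext (PiLp.ext h))
    obtain ⟨i, hi⟩ := this
    exact ⟨_, ⟨coordCM i, StarAlgebra.subset_adjoin ℂ _ ⟨i, rfl⟩, rfl⟩, hi⟩
  have hPg : P g := by
    refine hPlim g fun ε hε => ?_
    have hg : g ∈ closure (S : Set C(CB d, ℂ)) := by
      have : g ∈ S.topologicalClosure := hSdense ▸ StarSubalgebra.mem_top
      exact this
    obtain ⟨m, hm, hgm⟩ := Metric.mem_closure_iff.1 hg ε hε
    exact ⟨m, by simpa using hS m hm 1 hP1, by rwa [← dist_eq_norm]⟩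
  choose p hpf using fun n : ℕ => exists_polyCM_near (hf n) (Nat.one_div_pos_of_nat (n := n) (α := ℝ))
  have hdiff : Tendsto (fun n => f n - polyCM (p n)) atTop (𝓝 0) := by
    refine squeeze_zero_norm (fun n => ?_) tendsto_one_div_add_atTop_nhds_zero_nat
    rw [norm_sub_rev]
    exact (hpf n).le
  have hp : IsNullSeq p := by
    obtain ⟨C, hC⟩ := hfb
    refine ⟨⟨C + 1, fun n z hz => ?_⟩, fun z hz => ?_⟩
    · have h1 : ‖polyCM (p n)‖ ≤ C + 1 := by
        have h2 := norm_le_insert' (polyCM (p n)) (f n)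
        have h3 : (1 : ℝ) / (n + 1) ≤ 1 := by
          rw [div_le_one (by positivity)]; linarith [n.cast_nonneg (α := ℝ)]
        linarith [hC n, hpf n]
      exact ((polyCM (p n)).norm_coe_le_norm ⟨z, by simpa using hz⟩).trans h1
    · let w : CB d := ⟨z, by simpa using hz.le⟩
      have h1 : Tendsto (fun n => (f n - polyCM (p n)) w) atTop (𝓝 0) :=
        ((continuous_eval_const w).tendsto 0).comp hdiff
      simpa using (hf0 w hz).sub h1
  have h1 : Tendsto (fun n => L (g * (f n - polyCM (p n)))) atTop (𝓝 0) := by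
    have h2 : Continuous fun h => L (g * h) := L.continuous.comp (continuous_const.mul continuous_id)
    simpa [Function.comp_def] using (h2.tendsto 0).comp hdiff
  have h2 := h1.add (hPg p hp)
  rw [add_zero] at h2
  refine h2.congr fun n => ?_
  rw [← map_add]
  congr 1
  ring

end BallAlgebra

section Separation

variable {d : ℕ}

/-- Real-valued continuous functions viewed as complex-valued ones. -/
def toComplexCM : C(CB d, ℝ) →L[ℝ] C(CB d, ℂ) :=
  Complex.ofRealCLM.compLeftContinuous ℝ (CB d)

@[simp] lemma toComplexCM_apply (u : C(CB d, ℝ)) (x : CB d) : toComplexCM u x = (u x : ℂ) := rfl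

lemma isClosed_sphereD : IsClosed (sphereD d) :=
  isClosed_eq (continuous_norm.comp continuous_subtype_val) continuous_const

/-- A complex-linear functional whose real part is bounded below on a complex subspace vanishes
there. -/
lemma eq_zero_of_forall_le_re {V : Type*} [AddCommGroup V] [Module ℂ V] (L : V →ₗ[ℂ] ℂ) (u : ℝ)
    (b : V) (h : ∀ c : ℂ, u ≤ (L (c • b)).re) : L b = 0 := by
  by_contra hb
  have hpos : 0 < Complex.normSq (L b) := Complex.normSq_pos.2 hb
  have h1 := h ((-((|u| + 1) / Complex.normSq (L b)) : ℝ) * starRingEnd ℂ (L b))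
  rw [map_smul, smul_eq_mul, mul_assoc, mul_comm (starRingEnd ℂ (L b)), Complex.mul_conj,
    ← Complex.ofReal_mul, Complex.ofReal_re, neg_mul, div_mul_cancel₀ _ hpos.ne'] at h1
  linarith [neg_abs_le u]

/-- A functional that is positive on densities supported near `K` is represented by a finite
regular measure. -/
lemma exists_measure_of_positive (L : C(CB d, ℂ) →L[ℂ] ℂ) (χ : C(CB d, ℝ))
    (hpos : ∀ u : C(CB d, ℝ), (∀ x, 0 ≤ u x) → 0 ≤ (L (toComplexCM (χ * u))).re)
    (him : ∀ u : C(CB d, ℝ), (∀ x, 0 ≤ u x) → (L (toComplexCM (χ * u))).im = 0) :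
    ∃ ν : Measure (CB d), IsFiniteMeasure ν ∧ ν.Regular ∧
      ∀ f : C(CB d, ℂ), ∫ x, f x ∂ν = L (toComplexCM χ * f) := by
  let Λ₀ : CompactlySupportedContinuousMap (CB d) ℝ →ₗ[ℝ] ℝ :=
    { toFun := fun f => (L (toComplexCM (χ * f.toContinuousMap))).re
      map_add' := fun f g => by
        rw [← Complex.add_re, ← map_add, ← map_add, ← mul_add]; rfl
      map_smul' := fun a f => by
        have h : toComplexCM (χ * (a • f).toContinuousMap) =
            (a : ℂ) • toComplexCM (χ * f.toContinuousMap) := by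
          ext x
          have : (a • f).toContinuousMap x = a * f x := rfl
          have h2 : f.toContinuousMap x = f x := rfl
          simp [this, h2]; ring
        rw [h, map_smul, smul_eq_mul, Complex.re_ofReal_mul]; rfl }
  let Λ : CompactlySupportedContinuousMap (CB d) ℝ →ₚ[ℝ] ℝ :=
    PositiveLinearMap.mk₀ Λ₀ fun f hf => hpos f.toContinuousMap fun x => hf x
  have hreg : (RealRMK.rieszMeasure Λ).Regular := RealRMK.regular_rieszMeasure Λ
  have hfin : IsFiniteMeasure (RealRMK.rieszMeasure Λ) := inferInstance
  have him' : ∀ u : C(CB d, ℝ), (L (toComplexCM (χ * u))).im = 0 := by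
    intro u
    have h1 := him (u ⊔ 0) fun x => by simp
    have h2 := him (-u ⊔ 0) fun x => by simp
    have h3 : u = (u ⊔ 0) - (-u ⊔ 0) := by
      ext x
      simp only [ContinuousMap.sub_apply, ContinuousMap.sup_apply, ContinuousMap.neg_apply,
        ContinuousMap.zero_apply]
      rcases le_total 0 (u x) with h | h
      · simp [h]
      · simp [h]
    rw [h3, mul_sub, map_sub, map_sub, Complex.sub_im, h1, h2, sub_zero]
  have hreal : ∀ u : C(CB d, ℝ), ((∫ x, u x ∂(RealRMK.rieszMeasure Λ) : ℝ) : ℂ) =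
      L (toComplexCM (χ * u)) := by
    intro u
    have h := RealRMK.integral_rieszMeasure Λ
      ⟨u, HasCompactSupport.of_compactSpace _⟩
    have h2 : ∫ x, u x ∂(RealRMK.rieszMeasure Λ) = (L (toComplexCM (χ * u))).re := h
    rw [h2]
    exact Complex.ext (by simp) (by simp [him' u])
  refine ⟨RealRMK.rieszMeasure Λ, hfin, hreg, fun f => ?_⟩
  let fr : C(CB d, ℝ) := ⟨fun x => (f x).re, by fun_prop⟩
  let fi : C(CB d, ℝ) := ⟨fun x => (f x).im, by fun_prop⟩
  have hf : f = toComplexCM fr + Complex.I • toComplexCM fi := by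
    ext x
    simp only [ContinuousMap.add_apply, ContinuousMap.smul_apply, toComplexCM_apply, smul_eq_mul]
    rw [mul_comm]
    exact (Complex.re_add_im (f x)).symm
  have hint : Integrable (fun x => f x) (RealRMK.rieszMeasure Λ) :=
    f.continuous.integrable_of_hasCompactSupport (HasCompactSupport.of_compactSpace _)
  have hmul : toComplexCM χ * f =
      toComplexCM (χ * fr) + Complex.I • toComplexCM (χ * fi) := by
    conv_lhs => rw [hf]
    ext x; simp; ring
  rw [← integral_re_add_im hint, hmul, map_add, map_smul, ← hreal, ← hreal]
  simp only [smul_eq_mul]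
  rw [mul_comm Complex.I]
  rfl

/-- Separation of a compact set that is null for all Henkin measures: there are functions in the
ball algebra with large real part on `K`, almost nonnegative real part on the sphere, and small
modulus on a prescribed closed set disjoint from `K`. -/
lemma exists_separating (hd : 1 ≤ d) {K W : Set (CB d)} {z₀ : CB d} (hK : IsClosed K)
    (hKS : K ⊆ sphereD d) (hKnull : ∀ μ : Measure (CB d), IsHenkin d μ → μ K = 0)
    (hW : IsClosed W) (hWS : W ⊆ insert z₀ (sphereD d)) (hz₀ : z₀ ∈ W) (hKW : Disjoint W K)
    {ε : ℝ} (hε : 0 < ε) :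
    ∃ F ∈ ballAlg d, (∀ x ∈ K, 1 < (F x).re) ∧ (∀ x ∈ sphereD d, -ε < (F x).re) ∧
      ∀ x ∈ W, ‖F x‖ < ε := by
  by_contra hcon
  push Not at hcon
  let G : Set C(CB d, ℂ) := {g | MapsTo g K {w | 1 < w.re}} ∩
    ({g | MapsTo g (sphereD d) {w | -ε < w.re}} ∩ {g | MapsTo g W (ball 0 ε)})
  have hGo : IsOpen G := by
    refine (ContinuousMap.isOpen_setOfPred_mapsTo hK.isCompact ?_).inter
      ((ContinuousMap.isOpen_setOfPred_mapsTo isClosed_sphereD.isCompact ?_).inter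
        (ContinuousMap.isOpen_setOfPred_mapsTo hW.isCompact isOpen_ball))
    · exact isOpen_lt continuous_const Complex.continuous_re
    · exact isOpen_lt continuous_const Complex.continuous_re
  have hGc : Convex ℝ G := by
    rintro f ⟨hf1, hf2, hf3⟩ g ⟨hg1, hg2, hg3⟩ a b ha hb hab
    have h1 : Convex ℝ {w : ℂ | 1 < w.re} := convex_halfSpace_re_gt 1
    have h2 : Convex ℝ {w : ℂ | -ε < w.re} := convex_halfSpace_re_gt (-ε)
    exact ⟨fun x hx => h1 (hf1 hx) (hg1 hx) ha hb hab,
      fun x hx => h2 (hf2 hx) (hg2 hx) ha hb hab,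
      fun x hx => convex_ball (0 : ℂ) ε (hf3 hx) (hg3 hx) ha hb hab⟩
  have hdisj : Disjoint G (ballAlg d) := by
    rw [Set.disjoint_left]
    rintro g ⟨h1, h2, h3⟩ hg
    obtain ⟨x, hx, hx2⟩ := hcon g hg (fun x hx => h1 hx) (fun x hx => h2 hx)
    exact hx2.not_gt (mem_ball_zero_iff.1 (h3 hx))
  have hAc : Convex ℝ (ballAlg d) := by
    intro f hf g hg a b _ _ _
    have h1 := (ballAlgSub d).smul_mem hf (a : ℂ)
    have h2 := (ballAlgSub d).smul_mem hg (b : ℂ)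
    exact (ballAlgSub d).add_mem h1 h2
  obtain ⟨L₀, u, hLG, hLA⟩ := RCLike.geometric_hahn_banach_open (𝕜 := ℂ) hGc hGo hAc hdisj
  have hL0 : ∀ f ∈ ballAlg d, L₀ f = 0 := fun f hf =>
    eq_zero_of_forall_le_re (L₀ : C(CB d, ℂ) →ₗ[ℂ] ℂ) u f fun c =>
      hLA _ ((ballAlgSub d).smul_mem hf c)
  have hu : u ≤ 0 := by simpa using hLA 0 (ballAlgSub d).zero_mem
  let L : C(CB d, ℂ) →L[ℂ] ℂ := -L₀
  have hL : ∀ f ∈ ballAlg d, L f = 0 := fun f hf => by simp [L, hL0 f hf]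
  have hG : ∀ g ∈ G, 0 < (L g).re := fun g hg => by
    have h : (L₀ g).re < u := hLG g hg
    simp only [L, neg_apply, Complex.neg_re]
    linarith
  obtain ⟨χ, hχW, hχK, hχ01⟩ := exists_continuous_zero_one_of_isClosed hW hK hKW
  set r : ℝ := min 1 ε with hr
  have hr0 : 0 < r := lt_min one_pos hε
  have hr1 : r ≤ 1 := min_le_left _ _
  have hrε : r ≤ ε := min_le_right _ _
  have hmem : ∀ g h : C(CB d, ℂ), (∀ x ∈ K, 2 ≤ (g x).re) → (∀ x ∈ sphereD d, 0 ≤ (g x).re) →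
      (∀ x ∈ W, g x = 0) → (∀ x ∈ insert z₀ (sphereD d), ‖h x‖ < r) → g + h ∈ G := by
    intro g h h1 h2 h3 h4
    refine ⟨fun x hx => ?_, fun x hx => ?_, fun x hx => ?_⟩
    · have h5 := h4 x (mem_insert_of_mem _ (hKS hx))
      have h6 := (abs_le.1 (Complex.abs_re_le_norm (h x))).1
      change 1 < ((g + h) x).re
      rw [ContinuousMap.add_apply, Complex.add_re]
      linarith [h1 x hx]
    · have h5 := h4 x (mem_insert_of_mem _ hx)
      have h6 := (abs_le.1 (Complex.abs_re_le_norm (h x))).1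
      change -ε < ((g + h) x).re
      rw [ContinuousMap.add_apply, Complex.add_re]
      linarith [h2 x hx]
    · have h5 := h4 x (hWS hx)
      rw [mem_ball_zero_iff, ContinuousMap.add_apply, h3 x hx, zero_add]
      linarith
  have hmem0 : ∀ g : C(CB d, ℂ), (∀ x ∈ K, 2 ≤ (g x).re) → (∀ x ∈ sphereD d, 0 ≤ (g x).re) →
      (∀ x ∈ W, g x = 0) → 0 < (L g).re := fun g h1 h2 h3 => by
    have := hG _ (hmem g 0 h1 h2 h3 (by simp [hr0]))
    rwa [add_zero] at this
  set g₀ : C(CB d, ℂ) := toComplexCM ((2 : ℝ) • χ) with hg₀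
  have hg₀K : ∀ x ∈ K, 2 ≤ (g₀ x).re := fun x hx => by simp [hg₀, hχK hx]
  have hg₀S : ∀ x, 0 ≤ (g₀ x).re := fun x => by simp [hg₀, (hχ01 x).1]
  have hg₀W : ∀ x ∈ W, g₀ x = 0 := fun x hx => by simp [hg₀, hχW hx]
  have hg₀n : ∀ x, ‖g₀ x‖ ≤ 2 := fun x => by
    simp [hg₀, abs_of_nonneg (hχ01 x).1, (hχ01 x).2]
  set N : ℝ := (L g₀).re with hN
  have hN0 : 0 < N := hmem0 g₀ hg₀K (fun x _ => hg₀S x) hg₀W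
  have hLb : ∀ (f : C(CB d, ℂ)) (s : ℝ), (∀ x ∈ insert z₀ (sphereD d), ‖f x‖ ≤ s) →
      ‖L f‖ ≤ 2 * N / r * s := by
    intro f s hs
    have hs0 : 0 ≤ s := (norm_nonneg _).trans (hs z₀ (mem_insert _ _))
    rcases eq_or_ne (L f) 0 with h0 | h0
    · rw [h0, norm_zero]; positivity
    have hLf : 0 < ‖L f‖ := norm_pos_iff.2 h0
    refine le_of_forall_pos_le_add fun δ hδ => ?_
    set δ' : ℝ := δ * r / (2 * N) with hδ'
    have hδ'0 : 0 < δ' := by positivity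
    set t : ℝ := r / (2 * (s + δ')) with ht
    have ht0 : 0 < t := by positivity
    set c : ℂ := ((-(t / ‖L f‖) : ℝ) : ℂ) * starRingEnd ℂ (L f) with hc
    have hcn : ‖c‖ = t := by
      rw [hc, norm_mul, Complex.norm_real, norm_neg, RCLike.norm_conj, Real.norm_of_nonneg
        (by positivity), div_mul_cancel₀ _ hLf.ne']
    have h1 := hG _ (hmem g₀ (c • f) hg₀K (fun x _ => hg₀S x) hg₀W fun x hx => by
      rw [ContinuousMap.smul_apply, norm_smul, hcn]
      calc t * ‖f x‖ ≤ t * (s + δ') := by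
            have := hs x hx
            gcongr; linarith
        _ = r / 2 := by rw [ht]; field_simp
        _ < r := by linarith)
    have h2 : (L (c • f)).re = -(t * ‖L f‖) := by
      rw [map_smul, smul_eq_mul, hc, mul_assoc, mul_comm (starRingEnd ℂ (L f)), Complex.mul_conj,
        ← Complex.ofReal_mul, Complex.ofReal_re, Complex.normSq_eq_norm_sq]
      field_simp
    rw [map_add, Complex.add_re, h2, ← hN] at h1
    have h3 : t * ‖L f‖ ≤ N := by linarith
    have h4 : ‖L f‖ ≤ N / t := by rw [le_div_iff₀ ht0]; linarith
    refine h4.trans (le_of_eq ?_)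
    rw [ht, hδ']
    field_simp
  have hpos : ∀ u : C(CB d, ℝ), (∀ x, 0 ≤ u x) → 0 ≤ (L (toComplexCM (χ * u))).re := by
    intro u hu
    by_contra! hneg
    set a := (L (toComplexCM (χ * u))).re with ha
    have hta : 0 < N / (-a) := div_pos hN0 (by linarith)
    have hnn : ∀ x, 0 ≤ N / (-a) * (χ x * u x) := fun x =>
      mul_nonneg hta.le (mul_nonneg (hχ01 x).1 (hu x))
    have h := hmem0 (g₀ + ((N / (-a) : ℝ) : ℂ) • toComplexCM (χ * u)) ?_ ?_ ?_
    · rw [map_add, map_smul, Complex.add_re, smul_eq_mul, Complex.re_ofReal_mul, ← ha, ← hN] at h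
      have : N / (-a) * a = -N := by
        rw [div_neg, neg_mul, div_mul_cancel₀ _ hneg.ne]
      linarith
    · intro x hx
      have h1 := hg₀K x hx
      have h2 := hnn x
      simp only [ContinuousMap.add_apply, ContinuousMap.smul_apply, toComplexCM_apply,
        ContinuousMap.mul_apply, smul_eq_mul, Complex.add_re, Complex.re_ofReal_mul,
        Complex.ofReal_re]
      linarith
    · intro x _
      have h1 := hg₀S x
      have h2 := hnn x
      simp only [ContinuousMap.add_apply, ContinuousMap.smul_apply, toComplexCM_apply,
        ContinuousMap.mul_apply, smul_eq_mul, Complex.add_re, Complex.re_ofReal_mul,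
        Complex.ofReal_re]
      linarith
    · intro x hx
      simp [hg₀W x hx, hχW hx]
  have him : ∀ u : C(CB d, ℝ), (∀ x, 0 ≤ u x) → (L (toComplexCM (χ * u))).im = 0 := by
    intro u _
    by_contra hne
    set a := (L (toComplexCM (χ * u))).im with ha
    have hre : ∀ x, (((N / a : ℝ) : ℂ) * (Complex.I * (((χ x * u x : ℝ)) : ℂ))).re = 0 := fun x => by
      rw [Complex.re_ofReal_mul, Complex.I_mul_re, Complex.ofReal_im, neg_zero, mul_zero]
    have h := hmem0 (g₀ + ((N / a : ℝ) : ℂ) • (Complex.I • toComplexCM (χ * u))) ?_ ?_ ?_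
    · rw [map_add, map_smul, map_smul, Complex.add_re, smul_eq_mul, smul_eq_mul,
        Complex.re_ofReal_mul, Complex.I_mul_re, ← ha, ← hN] at h
      have : N / a * -a = -N := by field_simp
      linarith
    · intro x hx
      simp only [ContinuousMap.add_apply, ContinuousMap.smul_apply, toComplexCM_apply,
        ContinuousMap.mul_apply, smul_eq_mul, Complex.add_re]
      rw [hre]
      linarith [hg₀K x hx]
    · intro x _
      simp only [ContinuousMap.add_apply, ContinuousMap.smul_apply, toComplexCM_apply,
        ContinuousMap.mul_apply, smul_eq_mul, Complex.add_re]
      rw [hre]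
      linarith [hg₀S x]
    · intro x hx
      simp [hg₀W x hx, hχW hx]
  obtain ⟨ν, hνfin, hνreg, hν⟩ := exists_measure_of_positive L χ hpos him
  have hνre : ∀ u : C(CB d, ℝ), ∫ x, u x ∂ν = (L (toComplexCM (χ * u))).re := by
    intro u
    have h1 : toComplexCM (χ * u) = toComplexCM χ * toComplexCM u := by ext x; simp
    rw [h1, ← hν]
    simp only [toComplexCM_apply]
    rw [integral_complex_ofReal, Complex.ofReal_re]
  have hνS : ν (sphereD d)ᶜ = 0 := by
    let v : C(CB d, ℝ) := ⟨fun x => 1 - ‖(x : EuclideanSpace ℂ (Fin d))‖, by fun_prop⟩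
    have hv0 : ∀ x, 0 ≤ v x := fun x => sub_nonneg.2 (norm_coe_le_one x)
    have h1 : ∫ x, v x ∂ν = 0 := by
      rw [hνre]
      have h2 := hLb (toComplexCM (χ * v)) 0 fun x hx => by
        rcases hx with rfl | hx
        · simp [hχW hz₀]
        · have : v x = 0 := sub_eq_zero.2 (Eq.symm hx)
          simp [this]
      rw [mul_zero, norm_le_zero_iff] at h2
      rw [h2, Complex.zero_re]
    have hint : Integrable (fun x => v x) ν :=
      v.continuous.integrable_of_hasCompactSupport (HasCompactSupport.of_compactSpace _)
    rw [integral_eq_zero_iff_of_nonneg hv0 hint] at h1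
    have h3 : ∀ᵐ x ∂ν, x ∈ sphereD d := by
      filter_upwards [h1] with x hx
      exact (sub_eq_zero.1 hx).symm
    exact mem_ae_iff.1 h3
  have hHenkin : IsHenkin d ν := by
    refine ⟨hνfin, hνreg, hνS, fun f hf hfb hf0 => ?_⟩
    simp only [hν]
    exact tendsto_mul_of_annihilates hd L hL z₀ _ hLb (toComplexCM χ) f hf hfb hf0
  have hνK := hKnull ν hHenkin
  obtain ⟨V, hKV, hVo, hV⟩ := K.exists_isOpen_lt_of_lt (μ := ν) (ENNReal.ofReal (r * N / 8))
    (by rw [hνK]; exact ENNReal.ofReal_pos.2 (by positivity))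
  obtain ⟨b, hbV, hbK, hb01⟩ := exists_continuous_zero_one_of_isClosed hVo.isClosed_compl hK
    (disjoint_compl_left_iff_subset.2 hKV)
  have h1 := hG _ (hmem (toComplexCM (χ * ((2 : ℝ) • b))) (((-(r / 4) : ℝ) : ℂ) • g₀) ?_ ?_ ?_ ?_)
  · rw [map_add, map_smul, Complex.add_re, ← hνre, smul_eq_mul, Complex.re_ofReal_mul, ← hN] at h1
    have h2 : ∫ x, ((2 : ℝ) • b) x ∂ν ≤ 2 * ν.real V := by
      simp only [ContinuousMap.smul_apply, smul_eq_mul]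
      rw [integral_const_mul]
      gcongr
      rw [← integral_indicator_one hVo.measurableSet]
      refine integral_mono
        (b.continuous.integrable_of_hasCompactSupport (HasCompactSupport.of_compactSpace _))
        ((integrable_const (1 : ℝ)).indicator hVo.measurableSet) fun x => ?_
      by_cases hx : x ∈ V
      · simpa [hx] using (hb01 x).2
      · simp [hx, hbV (show x ∈ Vᶜ from hx)]
    have h3 : ν.real V < r * N / 8 := by
      rw [Measure.real]
      exact (ENNReal.lt_ofReal_iff_toReal_lt (measure_ne_top ν V)).1 hV
    linarith
  · intro x hx
    simp [hχK hx, hbK hx]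
  · intro x _
    have : 0 ≤ χ x * (2 * b x) := mul_nonneg (hχ01 x).1 (mul_nonneg two_pos.le (hb01 x).1)
    simp only [toComplexCM_apply, ContinuousMap.mul_apply, ContinuousMap.smul_apply, smul_eq_mul,
      Complex.ofReal_re]
    exact this
  · intro x hx
    simp [hχW hx]
  · intro x _
    rw [ContinuousMap.smul_apply, norm_smul, Complex.norm_real, norm_neg,
      Real.norm_of_nonneg (by positivity)]
    nlinarith [hg₀n x]

end Separation

section Iteration

variable {d : ℕ}

lemma exists_exp_mem_ballAlg {F : C(CB d, ℂ)} (hF : F ∈ ballAlg d) :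
    ∃ G ∈ ballAlg d, ∀ x, G x = Complex.exp (F x) := by
  refine ⟨NormedSpace.exp F, ?_, fun x => ?_⟩
  · refine isClosed_ballAlg.mem_of_tendsto
      (NormedSpace.exp_series_hasSum_exp' (𝕂 := ℂ) F) (Eventually.of_forall fun s => ?_)
    exact (ballAlgSub d).sum_mem fun n _ =>
      (ballAlgSub d).smul_mem ((ballAlgSub d).pow_mem hF n) _
  · have h := (NormedSpace.exp_series_hasSum_exp' (𝕂 := ℂ) F).mapL
      (ContinuousMap.evalCLM ℂ x)
    have h2 := NormedSpace.exp_series_hasSum_exp' (𝕂 := ℂ) (F x)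
    rw [← Complex.exp_eq_exp_ℂ] at h2
    refine h.unique ?_
    simpa using h2

/-- A function in the ball algebra vanishing on `X` can be modified to become smaller on the
totally null set `E`, at a cost controlled by its current size on `E`, while almost preserving its
value at a given point. -/
lemma exists_smaller_on_null (hd : 1 ≤ d) {X E : Set (CB d)} (hTN : IsTotallyNull d E)
    (hclE : closure E ⊆ X ∪ E) {z : CB d} (hz : z ∉ X ∪ E) {ψ : C(CB d, ℂ)}
    (hψ : ψ ∈ ballAlg d) (hψX : ∀ x ∈ X, ψ x = 0) {a b δ : ℝ} (hψE : ∀ x ∈ E, ‖ψ x‖ < a)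
    (ha : 0 < a) (hb : 0 < b) (hδ : 0 < δ) :
    ∃ ψ' ∈ ballAlg d, (∀ x ∈ X, ψ' x = 0) ∧ (∀ x ∈ E, ‖ψ' x‖ < b) ∧ ‖ψ' - ψ‖ ≤ 3 * a + δ ∧
      ‖ψ' z - ψ z‖ ≤ δ := by
  set K : Set (CB d) := closure E ∩ {x | b / 2 ≤ ‖ψ x‖} with hKdef
  set W : Set (CB d) := insert z (sphereD d ∩ {x | a ≤ ‖ψ x‖}) with hWdef
  have hK : IsClosed K := isClosed_closure.inter
    (isClosed_le continuous_const ψ.continuous.norm)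
  have hW : IsClosed W := isClosed_singleton.union (isClosed_sphereD.inter
    (isClosed_le continuous_const ψ.continuous.norm))
  have hKE : K ⊆ E := by
    rintro x ⟨hx1, hx2⟩
    rcases hclE hx1 with h | h
    · have hx2 : b / 2 ≤ ‖ψ x‖ := hx2
      rw [hψX x h, norm_zero] at hx2
      linarith
    · exact h
  have hKW : Disjoint W K := by
    rw [Set.disjoint_left]
    rintro x (rfl | ⟨_, hx⟩) hxK
    · exact hz (Or.inr (hKE hxK))
    · exact (hψE x (hKE hxK)).not_ge hx
  have hn0 : 0 < ‖ψ‖ + 1 := by positivity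
  obtain ⟨M, hM0, hM⟩ : ∃ M : ℝ, 0 < M ∧ (‖ψ‖ + 1) * Real.exp (-M) < b := by
    have h1 : Tendsto (fun M : ℝ => (‖ψ‖ + 1) * Real.exp (-M)) atTop (𝓝 ((‖ψ‖ + 1) * 0)) :=
      Real.tendsto_exp_neg_atTop_nhds_zero.const_mul _
    rw [mul_zero] at h1
    exact ((eventually_gt_atTop 0).and (h1.eventually_lt_const hb)).exists
  set ε : ℝ := min (1 / 2) (δ / (2 * (‖ψ‖ + 1))) with hε
  have hε0 : 0 < ε := by positivity
  have hε2 : ε ≤ 1 / 2 := min_le_left _ _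
  have hεδ : (‖ψ‖ + 1) * (2 * ε) ≤ δ := by
    have : ε ≤ δ / (2 * (‖ψ‖ + 1)) := min_le_right _ _
    rw [le_div_iff₀ (by positivity)] at this
    linarith
  have hexpε : Real.exp ε < 2 := by
    have h1 : Real.exp ε ≤ Real.exp (1 / 2) := Real.exp_le_exp.2 hε2
    have h2 : Real.exp (1 / 2) * Real.exp (1 / 2) = Real.exp 1 := by
      rw [← Real.exp_add]; norm_num
    have h3 := Real.exp_one_lt_d9
    nlinarith [Real.exp_pos (1 / 2)]
  obtain ⟨F, hF, hFK, hFS, hFW⟩ := exists_separating hd hK (hKE.trans hTN.1)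
    (fun μ hμ => measure_mono_null hKE (hTN.2 μ hμ)) hW
    (insert_subset_insert inter_subset_left) (mem_insert _ _) hKW (div_pos hε0 hM0)
  obtain ⟨G, hG, hGF⟩ := exists_exp_mem_ballAlg ((ballAlgSub d).smul_mem hF (-(M : ℂ)))
  have hGn : ∀ x, ‖G x‖ = Real.exp (-(M * (F x).re)) := fun x => by
    rw [hGF, Complex.norm_exp]; simp
  have hGS : ∀ x ∈ sphereD d, ‖G x‖ < 2 := fun x hx => by
    rw [hGn]
    refine lt_of_le_of_lt (Real.exp_le_exp.2 ?_) hexpε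
    have := hFS x hx
    rw [← neg_div, div_lt_iff₀ hM0] at this
    linarith
  have hGW : ∀ x ∈ W, ‖G x - 1‖ ≤ 2 * ε := fun x hx => by
    have h1 : ‖((-(M : ℂ)) • F) x‖ ≤ ε := by
      have := hFW x hx
      rw [lt_div_iff₀ hM0] at this
      simp only [ContinuousMap.smul_apply, smul_eq_mul, norm_mul, norm_neg, Complex.norm_real,
        Real.norm_of_nonneg hM0.le]
      linarith
    rw [hGF]
    exact (Complex.norm_exp_sub_one_le (h1.trans (by linarith))).trans (by linarith)
  have hψn : ∀ x, ‖ψ x‖ ≤ ‖ψ‖ := ψ.norm_coe_le_norm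
  have hW' : ∀ x ∈ W, ‖(ψ * G) x - ψ x‖ ≤ δ := fun x hx => by
    have h1 : (ψ * G) x - ψ x = ψ x * (G x - 1) := by
      rw [ContinuousMap.mul_apply]; ring
    rw [h1, norm_mul]
    refine le_trans (mul_le_mul ?_ (hGW x hx) (norm_nonneg _) hn0.le) hεδ
    linarith [hψn x]
  refine ⟨ψ * G, (ballAlgSub d).mul_mem hψ hG, fun x hx => by simp [hψX x hx], fun x hx => ?_, ?_,
    hW' z (mem_insert _ _)⟩
  · rw [ContinuousMap.mul_apply, norm_mul]
    rcases le_or_gt (b / 2) ‖ψ x‖ with h | h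
    · have h1 := hFK x ⟨subset_closure hx, h⟩
      refine lt_of_le_of_lt (mul_le_mul ?_ ?_ (norm_nonneg _) hn0.le) hM
      · linarith [hψn x]
      · rw [hGn]
        exact Real.exp_le_exp.2 (by nlinarith)
    · have h1 := hGS x (hTN.1 hx)
      nlinarith [norm_nonneg (ψ x), norm_nonneg (G x)]
  · refine norm_le_of_sphereD hd ((ballAlgSub d).sub_mem ((ballAlgSub d).mul_mem hψ hG) hψ)
      (by positivity) fun x hx => ?_
    rw [ContinuousMap.sub_apply]
    rcases le_or_gt a ‖ψ x‖ with h | h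
    · linarith [hW' x (mem_insert_of_mem _ ⟨hx, h⟩)]
    · refine (norm_sub_le _ _).trans ?_
      rw [ContinuousMap.mul_apply, norm_mul]
      nlinarith [hGS x hx, norm_nonneg (ψ x), norm_nonneg (G x)]

/-- A function in the ball algebra vanishing on `X` but not at `z` can be replaced by one that
moreover vanishes on the totally null set `E`. -/
lemma exists_vanishing_on_union (hd : 1 ≤ d) {X E : Set (CB d)} (hTN : IsTotallyNull d E)
    (hclE : closure E ⊆ X ∪ E) {z : CB d} (hz : z ∉ X ∪ E) {φ : C(CB d, ℂ)}
    (hφ : φ ∈ ballAlg d) (hφX : ∀ x ∈ X, φ x = 0) (hφz : φ z ≠ 0) :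
    ∃ ψ ∈ ballAlg d, (∀ x ∈ X ∪ E, ψ x = 0) ∧ ψ z ≠ 0 := by
  set c : ℝ := ‖φ z‖ with hc
  have hc0 : 0 < c := norm_pos_iff.2 hφz
  set a : ℝ := ‖φ‖ + 1 with ha
  have ha0 : 0 < a := by positivity
  let T : ℕ → Type := fun n =>
    {ψ : C(CB d, ℂ) // ψ ∈ ballAlg d ∧ (∀ x ∈ X, ψ x = 0) ∧ ∀ x ∈ E, ‖ψ x‖ < a / 2 ^ n}
  have hstep : ∀ n (ψ : T n), ∃ ψ' : T (n + 1),
      ‖ψ'.1 - ψ.1‖ ≤ 3 * (a / 2 ^ n) + c / 2 / 2 / 2 ^ n ∧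
        ‖ψ'.1 z - ψ.1 z‖ ≤ c / 2 / 2 / 2 ^ n := by
    rintro n ⟨ψ, h1, h2, h3⟩
    obtain ⟨ψ', h1', h2', h3', h4, h5⟩ := exists_smaller_on_null hd hTN hclE hz h1 h2 h3
      (a := a / 2 ^ n) (b := a / 2 ^ (n + 1)) (δ := c / 2 / 2 / 2 ^ n)
      (by positivity) (by positivity) (by positivity)
    exact ⟨⟨ψ', h1', h2', h3'⟩, h4, h5⟩
  choose step hstep_norm hstep_z using hstep
  let f : ∀ n, T n := fun n => Nat.rec
    ⟨φ, hφ, hφX, fun x _ => by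
      rw [pow_zero, div_one]; exact (φ.norm_coe_le_norm x).trans_lt (lt_add_one _)⟩ step n
  have hf : ∀ n, f (n + 1) = step n (f n) := fun n => rfl
  have hcau : CauchySeq fun n => (f n).1 := by
    refine cauchySeq_of_le_geometric_two (C := 2 * (3 * a + c / 2 / 2)) fun n => ?_
    rw [dist_comm, dist_eq_norm, hf]
    exact (hstep_norm n (f n)).trans (le_of_eq (by ring))
  obtain ⟨ψ, hψ⟩ := cauchySeq_tendsto_of_complete hcau
  have hpt : ∀ x, Tendsto (fun n => (f n).1 x) atTop (𝓝 (ψ x)) := fun x =>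
    ((ContinuousMap.evalCLM ℂ x).continuous.tendsto ψ).comp hψ
  refine ⟨ψ, isClosed_ballAlg.mem_of_tendsto hψ (Eventually.of_forall fun n => (f n).2.1), ?_, ?_⟩
  · rintro x (hx | hx)
    · exact tendsto_nhds_unique (hpt x)
        (tendsto_const_nhds.congr fun n => ((f n).2.2.1 x hx).symm)
    · refine tendsto_nhds_unique (hpt x) (squeeze_zero_norm (fun n => ((f n).2.2.2 x hx).le) ?_)
      exact tendsto_const_nhds.div_atTop (tendsto_pow_atTop_atTop_of_one_lt one_lt_two)
  · have h := dist_le_of_le_geometric_two_of_tendsto₀ (C := c / 2) (f := fun n => (f n).1 z)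
      (fun n => by
        rw [dist_comm, dist_eq_norm, hf]
        exact hstep_z n (f n)) (hpt z)
    intro h0
    have h1 : dist ((f 0).1 z) (ψ z) = c := by rw [h0, dist_zero_right]; rfl
    rw [h1] at h
    linarith

end Iteration

/-- the union of a zero set and a suitable totally null Borel set is again
a zero set. -/
theorem stmt8 (d : ℕ) (hd : 1 ≤ d) (X : Set (CB d)) (hX : IsZeroSet d X)
    (E : Set (CB d)) (hEmeas : MeasurableSet E) (hTN : IsTotallyNull d E)
    (hclE : closure E ⊆ X ∪ E) :
    IsZeroSet d (X ∪ E) := by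
  obtain ⟨S, hS, rfl⟩ := hX
  refine ⟨IX d (ZS d S ∪ E), fun φ hφ => hφ.1, Subset.antisymm (fun z hz φ hφ => hφ.2 z hz) ?_⟩
  intro z hz
  by_contra hzn
  have hzX : ¬ ∀ φ ∈ S, φ z = 0 := fun h => hzn (Or.inl h)
  push Not at hzX
  obtain ⟨φ, hφS, hφz⟩ := hzX
  obtain ⟨ψ, hψ, hψ0, hψz⟩ := exists_vanishing_on_union hd hTN hclE hzn (hS hφS)
    (fun x hx => hx φ hφS) hφz
  exact hψz (hz ψ ⟨hψ, hψ0⟩)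

end
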